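/- The automorphism group Aut(C_{f_{c,s}}) contains a subgroup 𝒰 isomorphic to the semidirect product (K,+) : (F_4^* × L^*), of order 2^{2k} · 3 · (2^k − 1); concretely, 𝒰 is the subgroup of Sym(K) generated by all translations x ↦ x + a (a ∈ K) together with all multiplications x ↦ u x with u ∈ F_4^* · L^*. -/

import Mathlib

/-- The code `C_f` associated to a function `f : K → K`. -/
def code {K : Type*} [Field K] [Algebra (ZMod 2) K] (f : K → K) : Set (K → ZMod 2) :=
  {c | ∃ (α β : K) (ε : ZMod 2),
    c = fun x => Algebra.trace (ZMod 2) K (α * x) + Algebra.trace (ZMod 2) K (β * f x) + ε}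

/-- The automorphism group of a code `C ⊆ F₂^K`, as a subgroup of `Sym(K)`. -/
def autCode {K : Type*} (C : Set (K → ZMod 2)) : Subgroup (Equiv.Perm K) where
  carrier := {π | (fun c : K → ZMod 2 => c ∘ ⇑π) '' C = C}
  one_mem' := by
    have : (fun c : K → ZMod 2 => c ∘ ⇑(1 : Equiv.Perm K)) = id := by funext c; rfl
    simp [this]
  mul_mem' := by
    intro π σ hπ hσ
    have hcomp : (fun c : K → ZMod 2 => c ∘ ⇑(π * σ)) =
        (fun c : K → ZMod 2 => c ∘ ⇑σ) ∘ (fun c : K → ZMod 2 => c ∘ ⇑π) := by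
      funext c; rfl
    show (fun c : K → ZMod 2 => c ∘ ⇑(π * σ)) '' C = C
    rw [hcomp, Set.image_comp, show (fun c : K → ZMod 2 => c ∘ ⇑π) '' C = C from hπ]
    exact hσ
  inv_mem' := by
    intro π hπ
    show (fun c : K → ZMod 2 => c ∘ ⇑π⁻¹) '' C = C
    conv_lhs => rw [← show (fun c : K → ZMod 2 => c ∘ ⇑π) '' C = C from hπ]
    rw [← Set.image_comp]
    have : ((fun c : K → ZMod 2 => c ∘ ⇑π⁻¹) ∘ fun c : K → ZMod 2 => c ∘ ⇑π) = id := by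
      funext c
      show (c ∘ ⇑π) ∘ ⇑π⁻¹ = c
      funext x
      simp
    rw [this, Set.image_id]

/-- The trinomial family `f_{c,s}(x) = b x^(2^s+1) + (b x^(2^s+1))^(2^k) + c x^(2^k+1)`. -/
def fam {K : Type*} [Field K] (k s : ℕ) (b c : K) : K → K :=
  fun x => b * x ^ (2 ^ s + 1) + (b * x ^ (2 ^ s + 1)) ^ (2 ^ k) + c * x ^ (2 ^ k + 1)

/-- Every additive functional on a finite field of characteristic two is `x ↦ Tr (α x)`. -/
theorem exists_trace_mul_eq {K : Type*} [Field K] [Fintype K] [Algebra (ZMod 2) K]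
    (φ : K →+ ZMod 2) : ∃ α : K, ∀ x, φ x = Algebra.trace (ZMod 2) K (α * x) := by
  have hnd := traceForm_nondegenerate (ZMod 2) K
  obtain ⟨α, hα⟩ := (LinearMap.BilinForm.toDual (Algebra.traceForm (ZMod 2) K) hnd).surjective
    (φ.toZModLinearMap 2)
  refine ⟨α, fun x => ?_⟩
  have h := LinearMap.congr_fun hα x
  simpa [LinearMap.BilinForm.toDual_def, Algebra.traceForm_apply] using h.symm

/-- A code on a finite set is preserved by `π` as soon as it is mapped into itself. -/
theorem mem_autCode_of_comp_mem {K : Type*} [Finite K] {C : Set (K → ZMod 2)}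
    {π : Equiv.Perm K} (h : ∀ w ∈ C, w ∘ ⇑π ∈ C) : π ∈ autCode C := by
  show (fun w : K → ZMod 2 => w ∘ ⇑π) '' C = C
  refine Set.eq_of_subset_of_ncard_le (by rintro _ ⟨w, hw, rfl⟩; exact h w hw) ?_ (Set.toFinite C)
  rw [Set.ncard_image_of_injective _ (fun v w hvw => π.surjective.injective_comp_right hvw)]

/-- If `f ∘ π` is an additive image of `f` up to an additive map and a constant, and `π` is affine,
then `π` preserves the code of `f`. -/
theorem mem_autCode_code {K : Type*} [Field K] [Fintype K] [Algebra (ZMod 2) K] {f : K → K}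
    {π : Equiv.Perm K} (A D : K →+ K) (e u a : K) (hπ : ∀ x, π x = u * x + a)
    (hf : ∀ x, f (π x) = A (f x) + D x + e) : π ∈ autCode (code f) := by
  refine mem_autCode_of_comp_mem ?_
  rintro _ ⟨α, β, ε, rfl⟩
  let T : K →+ ZMod 2 := (Algebra.trace (ZMod 2) K).toAddMonoidHom.comp (AddMonoidHom.mulLeft β)
  obtain ⟨α', hα'⟩ := exists_trace_mul_eq (T.comp D)
  obtain ⟨β', hβ'⟩ := exists_trace_mul_eq (T.comp A)
  refine ⟨α * u + α', β', Algebra.trace (ZMod 2) K (α * a) + Algebra.trace (ZMod 2) K (β * e) + ε,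
    ?_⟩
  funext x
  have h1 : Algebra.trace (ZMod 2) K (β * D x) = _ := hα' x
  have h2 : Algebra.trace (ZMod 2) K (β * A (f x)) = _ := hβ' (f x)
  rw [Function.comp_apply, hf, hπ]
  simp only [mul_add, add_mul, map_add, h1, h2, ← mul_assoc]
  ring

section

variable {K : Type*} [Field K]

theorem translation_mem_autCode_fam [Fintype K] [Algebra (ZMod 2) K] (k s : ℕ) (b c : K)
    {π : Equiv.Perm K} {a : K} (hπ : ∀ x, π x = x + a) : π ∈ autCode (code (fam k s b c)) := by
  have : CharP K 2 := charP_of_injective_algebraMap (algebraMap (ZMod 2) K).injective 2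
  let D : K →+ K := AddMonoidHom.mk'
    (fun x => b * (x ^ 2 ^ s * a + a ^ 2 ^ s * x) + (b * (x ^ 2 ^ s * a + a ^ 2 ^ s * x)) ^ 2 ^ k
      + c * (x ^ 2 ^ k * a + a ^ 2 ^ k * x)) (by
        intro x y
        simp only [mul_pow, add_pow_char_pow]
        ring)
  refine mem_autCode_code (AddMonoidHom.id K) D (fam k s b c a) 1 a (by simpa using hπ) ?_
  intro x
  simp only [hπ, fam, D, AddMonoidHom.mk'_apply, AddMonoidHom.id_apply, pow_succ, mul_pow,
    add_pow_char_pow]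
  ring

theorem mul_mem_autCode_fam [Fintype K] [Algebra (ZMod 2) K] {k s : ℕ} (hk : Odd k) (hs : Odd s)
    (hcard : Fintype.card K = 2 ^ (2 * k)) (b : K) {c : K} (hc : c ^ 2 ^ k ≠ c)
    {π : Equiv.Perm K} {ω z : K} (hω : ω ^ 3 = 1) (hz : z ^ 2 ^ k = z)
    (hπ : ∀ x, π x = ω * z * x) : π ∈ autCode (code (fam k s b c)) := by
  have : CharP K 2 := charP_of_injective_algebraMap (algebraMap (ZMod 2) K).injective 2
  have hωpow : ∀ m : ℕ, Odd m → ω ^ (2 ^ m + 1) = 1 := by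
    intro m hm
    have h3 : 3 ∣ 2 ^ m + 1 := by simpa using hm.nat_add_dvd_pow_add_pow 2 1
    obtain ⟨t, ht⟩ := h3
    rw [ht, pow_mul, hω, one_pow]
  have hq : ∀ x : K, (x ^ 2 ^ k) ^ 2 ^ k = x := by
    intro x
    rw [← pow_mul, ← pow_add, ← two_mul, ← hcard, FiniteField.pow_card]
  have hc' : c ^ 2 ^ k - c ≠ 0 := sub_ne_zero.mpr hc
  obtain ⟨r, hr⟩ : ∃ r : K, r * (c ^ 2 ^ k - c) = c * (z ^ 2 - z ^ (2 ^ s + 1)) :=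
    ⟨_, div_mul_cancel₀ _ hc'⟩
  let A : K →+ K := AddMonoidHom.mk' (fun v => (z ^ (2 ^ s + 1) - r) * v + r * v ^ 2 ^ k) (by
    intro x y
    simp only [add_pow_char_pow]
    ring)
  refine mem_autCode_code A 0 0 (ω * z) 0 (by simpa using hπ) ?_
  intro x
  have hzs : (z ^ (2 ^ s + 1)) ^ 2 ^ k = z ^ (2 ^ s + 1) := by rw [pow_right_comm, hz]
  have hN : (x ^ (2 ^ k + 1)) ^ 2 ^ k = x ^ (2 ^ k + 1) := by
    rw [pow_right_comm, pow_succ, pow_succ, hq, mul_comm]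
  have hzk : z ^ (2 ^ k + 1) = z ^ 2 := by rw [pow_succ, hz, sq]
  have hs' : (ω * z * x) ^ (2 ^ s + 1) = z ^ (2 ^ s + 1) * x ^ (2 ^ s + 1) := by
    rw [mul_pow, mul_pow, hωpow s hs, one_mul]
  have hk' : (ω * z * x) ^ (2 ^ k + 1) = z ^ 2 * x ^ (2 ^ k + 1) := by
    rw [mul_pow, mul_pow, hωpow k hk, one_mul, hzk]
  simp only [hπ, fam, A, AddMonoidHom.mk'_apply, AddMonoidHom.zero_apply, add_zero, hs', hk',
    add_pow_char_pow, mul_pow c, hN, hq, mul_left_comm b (z ^ (2 ^ s + 1)),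
    mul_pow (z ^ (2 ^ s + 1)), hzs]
  linear_combination (-x ^ (2 ^ k + 1)) * hr

/-- The group of affine permutations `x ↦ u x + a` whose linear part `u` lies in `H`. -/
def affinePerm (H : Subgroup Kˣ) : Subgroup (Equiv.Perm K) where
  carrier := {π | ∃ u ∈ H, ∃ a : K, ∀ x, π x = u * x + a}
  one_mem' := ⟨1, H.one_mem, 0, by simp⟩
  mul_mem' := by
    rintro π σ ⟨u, hu, a, hπ⟩ ⟨v, hv, d, hσ⟩
    refine ⟨u * v, H.mul_mem hu hv, u * d + a, fun x => ?_⟩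
    rw [Equiv.Perm.mul_apply, hσ, hπ]
    push_cast
    ring
  inv_mem' := by
    rintro π ⟨u, hu, a, hπ⟩
    refine ⟨u⁻¹, H.inv_mem hu, -(↑u⁻¹ * a), fun x => ?_⟩
    rw [Equiv.Perm.inv_eq_iff_eq, hπ, mul_add, mul_neg, u.mul_inv_cancel_left,
      u.mul_inv_cancel_left]
    ring

theorem card_affinePerm (H : Subgroup Kˣ) :
    Nat.card (affinePerm H) = Nat.card K * Nat.card H := by
  rw [mul_comm, ← Nat.card_prod]
  symm
  refine Nat.card_eq_of_bijective
    (fun p : H × K => (⟨(Units.mulLeft (p.1 : Kˣ)).trans (Equiv.addRight p.2),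
      p.1, p.1.2, p.2, fun x => rfl⟩ : affinePerm H)) ⟨?_, ?_⟩
  · rintro ⟨u, a⟩ ⟨v, d⟩ h
    have h' : ∀ x : K, (u : Kˣ) * x + a = (v : Kˣ) * x + d := fun x =>
      Equiv.congr_fun (congrArg Subtype.val h) x
    have h0 : a = d := by simpa using h' 0
    have h1 := h' 1
    rw [h0] at h1
    simp only [mul_one, add_left_inj, Units.val_inj, SetLike.coe_eq_coe] at h1
    rw [h0, h1]
  · rintro ⟨π, u, hu, a, hπ⟩
    exact ⟨(⟨u, hu⟩, a), Subtype.ext (Equiv.ext fun x => (hπ x).symm)⟩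

theorem card_rootsOfUnity_of_dvd [Fintype K] {n : ℕ} (hn : n ∣ Fintype.card K - 1) :
    Nat.card (rootsOfUnity n K) = n := by
  have hpos : 0 < Fintype.card K - 1 := Nat.sub_pos_of_lt Fintype.one_lt_card
  obtain ⟨m, hm⟩ := hn
  have : NeZero n := ⟨by rintro rfl; omega⟩
  obtain ⟨g, hg⟩ := IsCyclic.exists_ofOrder_eq_natCard (α := Kˣ)
  have hg' : orderOf (g : K) = Fintype.card K - 1 := by
    rw [orderOf_units, hg, Nat.card_units, Nat.card_eq_fintype_card]
  have hprim := (IsPrimitiveRoot.orderOf (g : K)).pow (a := m) (b := n) (by omega)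
    (by rw [hg', hm, mul_comm])
  exact hprim.card_rootsOfUnity

/-- For odd `k`, the roots of unity of order dividing `3 (2^k - 1)` are the products of a cube root
of unity and a nonzero element fixed by `x ↦ x^(2^k)`. -/
theorem mem_rootsOfUnity_three_mul_iff {k : ℕ} (hk : Odd k) (u : Kˣ) :
    u ∈ rootsOfUnity (3 * (2 ^ k - 1)) K ↔
      ∃ ω z : K, ω ^ 3 = 1 ∧ z ^ 2 ^ k = z ∧ z ≠ 0 ∧ (u : K) = ω * z := by
  obtain ⟨t, ht⟩ : 3 ∣ 2 ^ k + 1 := by simpa using hk.nat_add_dvd_pow_add_pow 2 1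
  obtain ⟨m, rfl⟩ : ∃ m, t = m + 1 := ⟨t - 1, by have := Nat.two_pow_pos k; omega⟩
  have hq : 2 ^ k = 3 * m + 2 := by omega
  rw [mem_rootsOfUnity, hq, show 3 * m + 2 - 1 = 3 * m + 1 by omega]
  constructor
  · intro hu
    have hu' : (u ^ (3 * m + 1)) ^ 3 = 1 := by rw [← pow_mul, mul_comm, hu]
    have hz : (u * (u ^ (3 * m + 1))⁻¹) ^ (3 * m + 1) = 1 := by
      rw [mul_pow, inv_pow, pow_succ (u ^ (3 * m + 1)), pow_mul (u ^ (3 * m + 1)), hu', one_pow,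
        one_mul, mul_inv_cancel]
    refine ⟨↑(u ^ (3 * m + 1)), ↑(u * (u ^ (3 * m + 1))⁻¹), ?_, ?_, Units.ne_zero _, ?_⟩
    · rw [← Units.val_pow_eq_pow_val, hu', Units.val_one]
    · rw [← Units.val_pow_eq_pow_val, show 3 * m + 2 = 3 * m + 1 + 1 from rfl,
        pow_succ (u * (u ^ (3 * m + 1))⁻¹), hz, one_mul]
    · rw [← Units.val_mul, mul_comm u, mul_inv_cancel_left]
  · rintro ⟨ω, z, hω, hz, hz0, hu⟩
    have hz1 : z ^ (3 * m + 1) = 1 := mul_right_cancel₀ hz0 (by rw [← pow_succ, hz, one_mul])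
    rw [Units.ext_iff, Units.val_pow_eq_pow_val, hu, Units.val_one, mul_pow, pow_mul ω, hω, one_pow,
      mul_comm 3, pow_mul z, hz1, one_pow, one_mul]

theorem closure_eq_affinePerm {k : ℕ} (hk : Odd k) :
    Subgroup.closure {π : Equiv.Perm K |
        (∃ a : K, ∀ x, π x = x + a) ∨
        (∃ ω z : K, ω ^ 3 = 1 ∧ z ^ (2 ^ k) = z ∧ z ≠ 0 ∧ ∀ x, π x = ω * z * x)} =
      affinePerm (rootsOfUnity (3 * (2 ^ k - 1)) K) := by
  apply le_antisymm
  · rw [Subgroup.closure_le]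
    rintro π (⟨a, hπ⟩ | ⟨ω, z, hω, hz, hz0, hπ⟩)
    · exact ⟨1, one_mem _, a, by simpa using hπ⟩
    · have hω0 : ω ≠ 0 := by rintro rfl; simp at hω
      exact ⟨Units.mk0 (ω * z) (mul_ne_zero hω0 hz0),
        (mem_rootsOfUnity_three_mul_iff hk _).2 ⟨ω, z, hω, hz, hz0, rfl⟩, 0, by simpa using hπ⟩
  · rintro π ⟨u, hu, a, hπ⟩
    obtain ⟨ω, z, hω, hz, hz0, huz⟩ := (mem_rootsOfUnity_three_mul_iff hk u).1 hu
    have hprod : π = Equiv.addRight a * Units.mulLeft u := Equiv.ext hπ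
    rw [hprod]
    refine mul_mem (Subgroup.subset_closure (Or.inl ⟨a, fun x => rfl⟩))
      (Subgroup.subset_closure (Or.inr ⟨ω, z, hω, hz, hz0, fun x => ?_⟩))
    rw [← huz, Units.mulLeft_apply]

end

/-- `Aut(C_{f_{c,s}})` contains the subgroup `𝒰 ≅ (K,+) : (F₄^* × L^*)` of order
`2^(2k) · 3 · (2^k - 1)`: concretely, `𝒰` is the subgroup of `Sym(K)` generated by all
translations `x ↦ x + a` together with all multiplications `x ↦ u x` with
`u ∈ F₄^* · L^*`. -/
theorem stmt13 {K : Type*} [Field K] [Fintype K] [Algebra (ZMod 2) K]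
    (k s : ℕ) (hk : Odd k) (hs : Odd s) (hks : Nat.Coprime k s)
    (hcard : Fintype.card K = 2 ^ (2 * k))
    (b : K) (hb : ∀ x : K, x ≠ 0 → ∃ m : ℕ, x = b ^ m)
    (c : K) (hc : c ^ (2 ^ k) ≠ c) :
    ∃ U : Subgroup (Equiv.Perm K),
      U = Subgroup.closure {π : Equiv.Perm K |
          (∃ a : K, ∀ x, π x = x + a) ∨
          (∃ ω z : K, ω ^ 3 = 1 ∧ z ^ (2 ^ k) = z ∧ z ≠ 0 ∧ ∀ x, π x = ω * z * x)} ∧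
      U ≤ autCode (code (fam k s b c)) ∧
      Nat.card U = 2 ^ (2 * k) * (3 * (2 ^ k - 1)) := by
  refine ⟨_, rfl, ?_, ?_⟩
  · rw [Subgroup.closure_le]
    rintro π (⟨a, hπ⟩ | ⟨ω, z, hω, hz, -, hπ⟩)
    · exact translation_mem_autCode_fam k s b c hπ
    · exact mul_mem_autCode_fam hk hs hcard b hc hω hz hπ
  · have hdvd : 3 * (2 ^ k - 1) ∣ Fintype.card K - 1 := by
      have h3 : 3 ∣ 2 ^ k + 1 := by simpa using hk.nat_add_dvd_pow_add_pow 2 1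
      have hfac : 2 ^ (2 * k) - 1 = (2 ^ k + 1) * (2 ^ k - 1) := by
        rw [mul_comm 2 k, pow_mul]
        exact Nat.sq_sub_sq (2 ^ k) 1
      rw [hcard, hfac]
      exact Nat.mul_dvd_mul_right h3 _
    rw [closure_eq_affinePerm hk, card_affinePerm, card_rootsOfUnity_of_dvd hdvd,
      Nat.card_eq_fintype_card, hcard]
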